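/- arXiv:1708.06902 — 2 statements merged into one kernel-verified Lean document; each statement's English description precedes it below -/
import Mathlib

section
/- The equation Hf = f has at least one solution f ∈ C₀⁺[0,1]; that is, there exists a nontrivial nonnegative continuous function f on [0,1] with (Lf)(t)/(Lf)(0) = f(t) for all t ∈ [0,1]. -/
open MeasureTheory Set

/-- The Lyapunov integral operator `(L f)(t) = ∫₀¹∫₀¹ K(t,u,v) f(u) f(v) du dv`. -/
noncomputable def lyap (K : ℝ → ℝ → ℝ → ℝ) (f : ℝ → ℝ) (t : ℝ) : ℝ :=
  ∫ u in (0:ℝ)..1, ∫ v in (0:ℝ)..1, K t u v * f u * f v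

theorem exists_polynomial_eval_eq_det_id_add_smul {E : Type*} [NormedAddCommGroup E]
    [NormedSpace ℝ E] [FiniteDimensional ℝ E] (A : E →L[ℝ] E) :
    ∃ p : Polynomial ℝ, p.natDegree ≤ Module.finrank ℝ E ∧
      ∀ t : ℝ, p.eval t = (ContinuousLinearMap.id ℝ E + t • A).det := by
  let b := Module.finBasis ℝ E
  let M := LinearMap.toMatrix b b (A : E →ₗ[ℝ] E)
  refine ⟨(((Polynomial.X : Polynomial ℝ) • M.map Polynomial.C +
    (1 : Matrix _ _ ℝ).map Polynomial.C).det), ?_, fun t => ?_⟩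
  · simpa using Polynomial.natDegree_det_X_add_C_le M 1
  · rw [ContinuousLinearMap.det, ← LinearMap.det_toMatrix b, ← Polynomial.coe_evalRingHom,
      RingHom.map_det]
    congr 1
    ext i j
    by_cases hij : i = j <;>
      simp [M, hij, LinearMap.toMatrix_apply, add_comm, mul_comm t]

theorem det_id_add_smul_pos {E : Type*} [NormedAddCommGroup E]
    [NormedSpace ℝ E] [FiniteDimensional ℝ E] (A : E →L[ℝ] E) {C t : ℝ} (hA : ‖A‖ ≤ C)
    (ht : 0 ≤ t) (htC : t * C < 1) : 0 < (ContinuousLinearMap.id ℝ E + t • A).det := by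
  obtain ⟨p, -, hp⟩ := exists_polynomial_eval_eq_det_id_add_smul A
  have hC : 0 ≤ C := (norm_nonneg A).trans hA
  have hne : ∀ s ∈ Icc 0 t, p.eval s ≠ 0 := by
    intro s hs h0
    rw [hp] at h0
    have hker := LinearMap.bot_lt_ker_of_det_eq_zero h0
    obtain ⟨x, hx, hx0⟩ := (Submodule.ne_bot_iff _).1 hker.ne'
    have hx' : x = -(s • A x) := by
      rw [LinearMap.mem_ker] at hx
      exact eq_neg_of_add_eq_zero_left (by simpa using hx)
    have h1 : ‖x‖ ≤ s * (C * ‖x‖) := by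
      calc ‖x‖ = ‖s • A x‖ := by conv_lhs => rw [hx', norm_neg]
        _ = s * ‖A x‖ := by rw [norm_smul, Real.norm_of_nonneg hs.1]
        _ ≤ s * (C * ‖x‖) := by
          have := A.le_of_opNorm_le hA x
          have := hs.1
          gcongr
    have h2 : s * C ≤ t * C := by have := hs.2; gcongr
    have h3 : 0 < ‖x‖ := norm_pos_iff.2 hx0
    nlinarith
  by_contra! hle
  rw [← hp] at hle
  have h0 : p.eval 0 = 1 := by
    rw [hp]; simp [ContinuousLinearMap.det]
  obtain ⟨s, hs, hs0⟩ := intermediate_value_Icc' ht p.continuous.continuousOn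
    (show (0 : ℝ) ∈ Icc (p.eval t) (p.eval 0) from ⟨hle, by rw [h0]; exact zero_le_one⟩)
  exact hne s hs hs0

theorem LipschitzOnWith.lipschitzWith_indicator_closedBall {E F : Type*} [NormedAddCommGroup E]
    [NormedSpace ℝ E] [NormedAddCommGroup F] {C : NNReal} {g : E → F}
    (hg : LipschitzOnWith C g (Metric.closedBall 0 1)) (h0 : ∀ x, ‖x‖ = 1 → g x = 0) :
    LipschitzWith C ((Metric.closedBall (0 : E) 1).indicator g) := by
  have key : ∀ x y : E, ‖x‖ ≤ 1 → 1 < ‖y‖ → ‖g x‖ ≤ C * ‖x - y‖ := by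
    intro x y hx hy
    have hc : ContinuousOn (fun s : ℝ => ‖AffineMap.lineMap x y s‖) (Icc (0:ℝ) 1) := by
      apply Continuous.continuousOn
      exact (AffineMap.lineMap_continuous).norm
    obtain ⟨s, hs, hs1⟩ := intermediate_value_Icc zero_le_one hc
      (show (1 : ℝ) ∈ Icc _ _ by simpa using ⟨hx, hy.le⟩)
    have h1 := hg.dist_le_mul x (by simpa using hx) (AffineMap.lineMap x y s)
      (by simpa using hs1.le)
    rw [h0 _ hs1, dist_zero_right, dist_left_lineMap, Real.norm_of_nonneg hs.1, dist_eq_norm] at h1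
    refine h1.trans ?_
    have := mul_le_of_le_one_left (norm_nonneg (x - y)) hs.2
    gcongr
  refine LipschitzWith.of_dist_le_mul fun x y => ?_
  by_cases hx : x ∈ Metric.closedBall (0 : E) 1 <;> by_cases hy : y ∈ Metric.closedBall (0 : E) 1
  · simpa [hx, hy] using hg.dist_le_mul x hx y hy
  · rw [indicator_of_mem hx, indicator_of_notMem hy, dist_zero_right, dist_eq_norm]
    exact key x y (by simpa using hx) (by simpa using hy)
  · rw [indicator_of_mem hy, indicator_of_notMem hx, dist_zero_left, dist_comm, dist_eq_norm]
    exact key y x (by simpa using hy) (by simpa using hx)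
  · simp [hx, hy]
    positivity

theorem LipschitzWith.bijective_id_add_smul {E : Type*} [NormedAddCommGroup E]
    [NormedSpace ℝ E] [CompleteSpace E] {C : NNReal} {g : E → E} (hg : LipschitzWith C g)
    {t : ℝ} (ht : 0 ≤ t) (htC : t * C < 1) : Function.Bijective fun x => x + t • g x := by
  rcases subsingleton_or_nontrivial E with hE | hE
  · exact ⟨fun _ _ _ => Subsingleton.elim _ _, fun y => ⟨y, Subsingleton.elim _ _⟩⟩
  have h : ApproximatesLinearOn (fun x => x + t • g x)
      ((ContinuousLinearEquiv.refl ℝ E : E ≃L[ℝ] E) : E →L[ℝ] E) univ (t.toNNReal * C) := by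
    rw [ApproximatesLinearOn.approximatesLinearOn_iff_lipschitzOnWith, lipschitzOnWith_univ]
    refine LipschitzWith.of_dist_le_mul fun x y => ?_
    simp only [Pi.sub_apply, ContinuousLinearEquiv.coe_refl, add_sub_cancel_left, ContinuousLinearMap.coe_id',
      id, dist_smul₀]
    rw [NNReal.coe_mul, Real.coe_toNNReal _ ht, mul_assoc, Real.norm_of_nonneg ht]
    have := hg.dist_le_mul x y
    gcongr
  have hc : t.toNNReal * C <
      ‖((ContinuousLinearEquiv.refl ℝ E).symm : E →L[ℝ] E)‖₊⁻¹ := by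
    rw [← NNReal.coe_lt_coe]
    simpa [Real.coe_toNNReal _ ht] using htC
  exact ⟨injOn_univ.1 (h.injOn (Or.inr hc)), h.surjective (Or.inr hc)⟩

open Metric in
/-- If `r` is continuously differentiable near the closed unit ball and fixes the unit sphere, then
the integral of its Jacobian determinant over the ball is the volume of the ball. -/
theorem setIntegral_closedBall_det_fderiv_of_eq_on_sphere {E : Type*} [NormedAddCommGroup E]
    [InnerProductSpace ℝ E] [FiniteDimensional ℝ E] [MeasurableSpace E] [BorelSpace E]
    {U : Set E} (hU : IsOpen U) (hBU : closedBall 0 1 ⊆ U) {r : E → E} (hr : ContDiffOn ℝ 1 r U)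
    (hr1 : ∀ x, ‖x‖ = 1 → r x = x) :
    ∫ x in closedBall (0 : E) 1, (fderiv ℝ r x).det = volume.real (closedBall (0 : E) 1) := by
  set B := closedBall (0 : E) 1 with hB
  have hBc : IsCompact B := isCompact_closedBall 0 1
  have hdr : ∀ x ∈ B, DifferentiableAt ℝ r x := fun x hx =>
    (hr.contDiffAt (hU.mem_nhds (hBU hx))).differentiableAt one_ne_zero
  set D : E → E →L[ℝ] E := fun x => fderiv ℝ r x - ContinuousLinearMap.id ℝ E with hD
  have hDc : ContinuousOn D B :=
    ((hr.continuousOn_fderiv_of_isOpen hU le_rfl).mono hBU).sub continuousOn_const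
  set g : E → E := fun x => r x - x with hg
  have hgD : ∀ x ∈ B, HasFDerivAt g (D x) x := fun x hx =>
    (hdr x hx).hasFDerivAt.sub (hasFDerivAt_id x)
  obtain ⟨C₀, hC₀⟩ := hBc.exists_bound_of_continuousOn hDc
  set C : NNReal := C₀.toNNReal with hC
  have hDC : ∀ x ∈ B, ‖D x‖ ≤ C := fun x hx => (hC₀ x hx).trans (Real.le_coe_toNNReal _)
  have hLip : LipschitzOnWith C g B :=
    (convex_closedBall 0 1).lipschitzOnWith_of_nnnorm_hasFDerivWithin_le
      (fun x hx => (hgD x hx).hasFDerivWithinAt) (fun x hx => hDC x hx)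
  have hLip' := hLip.lipschitzWith_indicator_closedBall
    (fun x hx => by simp [hg, hr1 x hx])
  have hdetc : ∀ t : ℝ, ContinuousOn (fun x => (ContinuousLinearMap.id ℝ E + t • D x).det) B :=
    fun t => ContinuousLinearMap.continuous_det.comp_continuousOn
      (continuousOn_const.add (hDc.const_smul t))
  have hvol : ∀ t : ℝ, 0 ≤ t → t * C < 1 →
      ∫ x in B, (ContinuousLinearMap.id ℝ E + t • D x).det = volume.real B := by
    intro t ht htC
    have hbij := hLip'.bijective_id_add_smul ht htC
    set φ : E → E := fun x => x + t • g x with hφ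
    have himg : φ '' B = B := by
      have hon : ∀ x ∈ B, x + t • B.indicator g x = φ x := fun x hx => by
        simp [hφ, indicator_of_mem hx]
      have hoff : ∀ x ∉ B, x + t • B.indicator g x = x := fun x hx => by
        simp [indicator_of_notMem hx]
      ext y
      constructor
      · rintro ⟨x, hx, rfl⟩
        by_contra hy
        have : x = φ x := hbij.1 (by
          simp only
          rw [hon x hx, hoff _ hy])
        exact hy (this ▸ hx)
      · intro hy
        obtain ⟨x, hx⟩ := hbij.2 y
        by_cases hxB : x ∈ B
        · exact ⟨x, hxB, (hon x hxB).symm.trans hx⟩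
        · exact absurd ((hoff x hxB).symm.trans hx ▸ hy) hxB
    have hinj : InjOn φ B := by
      intro x hx y hy hxy
      apply hbij.1
      simp only
      rw [indicator_of_mem hx, indicator_of_mem hy]
      exact hxy
    have hφ' : ∀ x ∈ B, HasFDerivWithinAt φ (ContinuousLinearMap.id ℝ E + t • D x) B x :=
      fun x hx => ((hasFDerivAt_id x).add ((hgD x hx).const_smul t)).hasFDerivWithinAt
    have h := integral_image_eq_integral_abs_det_fderiv_smul volume
      measurableSet_closedBall hφ' hinj (fun _ => (1 : ℝ))
    rw [himg] at h
    simp only [integral_const, smul_eq_mul, mul_one, measureReal_restrict_apply_univ] at h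
    rw [h]
    refine setIntegral_congr_fun measurableSet_closedBall fun x hx => ?_
    exact (abs_of_pos (det_id_add_smul_pos (D x) (hDC x hx) ht htC)).symm
  choose p hpdeg hp using fun x => exists_polynomial_eval_eq_det_id_add_smul (D x)
  set d := Module.finrank ℝ E
  set v : ℕ → ℝ := fun i => ((i : ℝ) + 1 + C)⁻¹ with hv
  have hvinj : InjOn v (Finset.range (d + 1)) := by
    intro i _ j _ hij
    simpa [hv] using hij
  have hv0 : ∀ i, 0 ≤ v i := fun i => by positivity
  have hvC : ∀ i, v i * C < 1 := fun i => by
    rw [hv, inv_mul_lt_iff₀ (by positivity)]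
    have : (0 : ℝ) ≤ i := i.cast_nonneg
    linarith
  set c : ℕ → ℝ := fun i => (Lagrange.basis (Finset.range (d + 1)) v i).eval 1 with hc
  have hcsum : ∑ i ∈ Finset.range (d + 1), c i = 1 := by
    rw [hc, ← Polynomial.eval_finsetSum, Lagrange.sum_basis hvinj (by simp), Polynomial.eval_one]
  have hdet : ∀ x, (fderiv ℝ r x).det =
      ∑ i ∈ Finset.range (d + 1), c i * (ContinuousLinearMap.id ℝ E + v i • D x).det := by
    intro x
    have h1 : (p x).eval 1 = (fderiv ℝ r x).det := by rw [hp]; simp [hD]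
    rw [← h1, Lagrange.eq_interpolate (f := p x) hvinj
      (by
        rw [Finset.card_range]
        exact (Polynomial.degree_le_of_natDegree_le (hpdeg x)).trans_lt
          (by exact_mod_cast d.lt_succ_self)),
      Lagrange.interpolate_apply, Polynomial.eval_finsetSum]
    refine Finset.sum_congr rfl fun i _ => ?_
    rw [Polynomial.eval_mul, Polynomial.eval_C, hp, mul_comm]
  simp_rw [hdet]
  rw [integral_finsetSum]
  · simp_rw [integral_const_mul, hvol _ (hv0 _) (hvC _)]
    rw [← Finset.sum_mul, hcsum, one_mul]
  · intro i _
    exact ((hdetc (v i)).integrableOn_compact hBc).const_mul _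

open Metric in
theorem not_exists_contDiffOn_retraction_sphere {E : Type*} [NormedAddCommGroup E]
    [InnerProductSpace ℝ E] [FiniteDimensional ℝ E]
    {U : Set E} (hU : IsOpen U) (hBU : closedBall 0 1 ⊆ U) {r : E → E} (hr : ContDiffOn ℝ 1 r U)
    (hr1 : ∀ x, ‖x‖ = 1 → r x = x) (hrS : ∀ x ∈ U, ‖r x‖ = 1) : False := by
  borelize E
  have h := setIntegral_closedBall_det_fderiv_of_eq_on_sphere hU hBU hr hr1
  have hz : ∀ x ∈ closedBall (0 : E) 1, (fderiv ℝ r x).det = 0 := by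
    intro x hx
    have hd : HasFDerivAt r (fderiv ℝ r x) x :=
      ((hr.contDiffAt (hU.mem_nhds (hBU hx))).differentiableAt one_ne_zero).hasFDerivAt
    by_contra hne
    have hsurj : Function.Surjective (fderiv ℝ r x) := by
      have := LinearMap.range_eq_top.1
        (LinearEquiv.range (LinearMap.equivOfDetNeZero (fderiv ℝ r x : E →ₗ[ℝ] E) hne))
      exact this
    obtain ⟨w, hw⟩ := hsurj (r x)
    have hconst : (fun y => ‖r y‖ ^ 2) =ᶠ[nhds x] fun _ => 1 := by
      filter_upwards [hU.mem_nhds (hBU hx)] with y hy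
      simp [hrS y hy]
    have h0 := hd.norm_sq.unique ((hasFDerivAt_const (1 : ℝ) x).congr_of_eventuallyEq hconst)
    have h1 := congrArg (fun L => L w) h0
    simp [hw, hrS x (hBU hx)] at h1
  rw [setIntegral_congr_fun measurableSet_closedBall hz] at h
  have hpos : 0 < volume.real (closedBall (0 : E) 1) :=
    ENNReal.toReal_pos (measure_closedBall_pos volume _ one_pos).ne' measure_closedBall_lt_top.ne
  simp at h
  linarith

/-- Brouwer's fixed point theorem for continuously differentiable maps into the unit sphere. -/
theorem exists_fixedPoint_of_contDiff_sphere {E : Type*} [NormedAddCommGroup E]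
    [InnerProductSpace ℝ E] [FiniteDimensional ℝ E] {N : E → E} (hN : ContDiff ℝ 1 N)
    (hN1 : ∀ x, ‖N x‖ = 1) : ∃ x, N x = x := by
  by_contra! hfix
  set u : E → E := fun x => x - N x with hu
  have hu0 : ∀ x, 0 < ‖u x‖ ^ 2 := fun x => by
    have : u x ≠ 0 := sub_ne_zero.2 (hfix x).symm
    positivity
  have hucd : ContDiff ℝ 1 u := contDiff_id.sub hN
  set disc : E → ℝ := fun x => inner ℝ x (u x) ^ 2 + ‖u x‖ ^ 2 * (1 - ‖x‖ ^ 2) with hdisc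
  have hdcd : ContDiff ℝ 1 disc :=
    ((contDiff_id.inner ℝ hucd).pow 2).add
      ((hucd.norm_sq ℝ).mul (contDiff_const.sub (contDiff_id.norm_sq ℝ)))
  set s : E → ℝ := fun x => (-inner ℝ x (u x) + Real.sqrt (disc x)) / ‖u x‖ ^ 2 with hs
  have hsphere : ∀ x : E, ‖x‖ = 1 → 0 < inner ℝ x (u x) := by
    intro x hx
    have h1 := inner_lt_one_iff_real_of_norm_eq_one hx (hN1 x)
    have h2 := h1.2 (hfix x).symm
    rw [hu, inner_sub_right, real_inner_self_eq_norm_sq, hx]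
    linarith
  refine not_exists_contDiffOn_retraction_sphere (U := {x | 0 < disc x})
    (r := fun x => x + s x • u x) (isOpen_lt continuous_const hdcd.continuous) ?_ ?_ ?_ ?_
  · intro x hx
    have hx : ‖x‖ ≤ 1 := by simpa using hx
    rcases hx.lt_or_eq with h | h
    · have : 0 < 1 - ‖x‖ ^ 2 := by nlinarith [norm_nonneg x]
      have := mul_pos (hu0 x) this
      simp only [mem_ofPred_eq, hdisc]
      positivity
    · have := hsphere x h
      simp only [mem_ofPred_eq, hdisc, h]
      norm_num
      positivity
  · refine contDiffOn_id.add (ContDiffOn.smul ?_ hucd.contDiffOn)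
    refine ContDiffOn.div ?_ (hucd.norm_sq ℝ).contDiffOn fun x _ => (hu0 x).ne'
    exact (contDiff_id.inner ℝ hucd).neg.contDiffOn.add
      (hdcd.contDiffOn.sqrt fun x hx => ne_of_gt hx)
  · intro x hx
    have h1 := hsphere x hx
    have : s x = 0 := by simp [hs, hdisc, hx, Real.sqrt_sq h1.le]
    simp [this]
  · intro x hx
    have h1 : s x * ‖u x‖ ^ 2 = -inner ℝ x (u x) + Real.sqrt (disc x) :=
      div_mul_cancel₀ _ (hu0 x).ne'
    have h2 := Real.sq_sqrt (le_of_lt hx)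
    have h3 : ‖x + s x • u x‖ ^ 2 = 1 := by
      rw [norm_add_sq_real, inner_smul_right, norm_smul, mul_pow, Real.norm_eq_abs, sq_abs]
      have h4 : ‖u x‖ ^ 2 * (‖x‖ ^ 2 + 2 * (s x * inner ℝ x (u x)) + s x ^ 2 * ‖u x‖ ^ 2 - 1)
          = 0 := by
        have h5 : disc x = (s x * ‖u x‖ ^ 2 + inner ℝ x (u x)) ^ 2 := by
          rw [h1, ← h2, Real.sqrt_sq (Real.sqrt_nonneg _)]; ring
        rw [hdisc] at h5
        simp only at h5
        linear_combination -h5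
      have h6 := (mul_eq_zero.1 h4).resolve_left (hu0 x).ne'
      linarith
    exact (pow_eq_one_iff_of_nonneg (norm_nonneg _) two_ne_zero).1 h3

theorem exists_pos_eigenvector_of_quadratic_pos {ι : Type*} [Fintype ι] [Nonempty ι]
    (a : ι → ι → ι → ℝ) (ha : ∀ i j k, 0 < a i j k) :
    ∃ z : ι → ℝ, (∀ i, 0 < z i) ∧ ∃ c > 0, ∀ i, z i = c * ∑ j, ∑ k, a i j k * z j * z k := by
  set Q : ι → EuclideanSpace ℝ ι → ℝ := fun i x => ∑ j, ∑ k, a i j k * x j ^ 2 * x k ^ 2 with hQ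
  set P : ι → EuclideanSpace ℝ ι → ℝ := fun i x => Q i x + (1 - ‖x‖ ^ 2) ^ 2 with hP
  have hQ0 : ∀ i x, 0 ≤ Q i x := fun i x =>
    Finset.sum_nonneg fun j _ => Finset.sum_nonneg fun k _ => by
      have := ha i j k
      positivity
  have hQpos : ∀ i x, x ≠ 0 → 0 < Q i x := by
    intro i x hx
    obtain ⟨j, hj⟩ : ∃ j, x j ≠ 0 := by
      by_contra! h
      exact hx (PiLp.ext h)
    have hnn : ∀ j k, 0 ≤ a i j k * x j ^ 2 * x k ^ 2 := fun j k => by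
      have := ha i j k
      positivity
    refine Finset.sum_pos' (fun j _ => Finset.sum_nonneg fun k _ => hnn j k)
      ⟨j, Finset.mem_univ j, Finset.sum_pos' (fun k _ => hnn j k) ⟨j, Finset.mem_univ j, ?_⟩⟩
    have := ha i j j
    positivity
  have hPpos : ∀ i x, 0 < P i x := by
    intro i x
    rcases eq_or_ne x 0 with rfl | hx
    · have := hQ0 i 0
      simp only [hP, norm_zero]
      linarith
    · have := hQpos i x hx
      positivity
  have hPcd : ∀ i, ContDiff ℝ 1 (P i) := by
    intro i
    refine ContDiff.add ?_ ((contDiff_const.sub (contDiff_id.norm_sq ℝ)).pow 2)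
    refine ContDiff.sum fun j _ => ContDiff.sum fun k _ => ?_
    fun_prop
  set G : EuclideanSpace ℝ ι → EuclideanSpace ℝ ι :=
    fun x => WithLp.toLp 2 fun i => Real.sqrt (P i x) with hG
  have hGcd : ContDiff ℝ 1 G := by
    rw [contDiff_euclidean]
    exact fun i => (hPcd i).sqrt fun x => (hPpos i x).ne'
  have hG0 : ∀ x, G x ≠ 0 := by
    intro x h
    obtain ⟨i⟩ := ‹Nonempty ι›
    have h1 : Real.sqrt (P i x) = 0 := congrArg (fun y : EuclideanSpace ℝ ι => y i) h
    exact (Real.sqrt_pos.2 (hPpos i x)).ne' h1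
  obtain ⟨x, hx⟩ := exists_fixedPoint_of_contDiff_sphere (N := fun x => ‖G x‖⁻¹ • G x)
    (((hGcd.norm ℝ hG0).inv fun x => norm_ne_zero_iff.2 (hG0 x)).smul hGcd)
    (fun x => by
      rw [norm_smul, norm_inv, norm_norm, inv_mul_cancel₀ (norm_ne_zero_iff.2 (hG0 x))])
  have hx1 : ‖x‖ = 1 := by
    rw [← hx, norm_smul, norm_inv, norm_norm, inv_mul_cancel₀ (norm_ne_zero_iff.2 (hG0 x))]
  have hpos := norm_pos_iff.2 (hG0 x)
  have hxi : ∀ i, x i ^ 2 = (‖G x‖⁻¹) ^ 2 * Q i x := by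
    intro i
    have h1 : x i = ‖G x‖⁻¹ * Real.sqrt (P i x) :=
      congrArg (fun y : EuclideanSpace ℝ ι => y i) hx.symm
    rw [h1, mul_pow, Real.sq_sqrt (hPpos i x).le]
    simp [hP, hx1]
  have hx0 : x ≠ 0 := fun h => by simp [h] at hx1
  refine ⟨fun i => x i ^ 2, fun i => ?_, (‖G x‖⁻¹) ^ 2, by positivity, hxi⟩
  have := hQpos i x hx0
  simp only [hxi]
  positivity

theorem abs_sum_div_sub_integral_le {φ : ℝ → ℝ} (hφ : Continuous φ) {n : ℕ} (hn : 0 < n) {ε : ℝ}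
    (h : ∀ x ∈ Icc (0:ℝ) 1, ∀ y ∈ Icc (0:ℝ) 1, |x - y| ≤ 1 / n → |φ x - φ y| ≤ ε) :
    |(∑ j ∈ Finset.range n, φ (j / n)) / n - ∫ x in (0:ℝ)..1, φ x| ≤ ε := by
  have hn' : (0:ℝ) < n := by exact_mod_cast hn
  have hsum := intervalIntegral.sum_integral_adjacent_intervals (μ := volume) (f := φ)
    (a := fun j : ℕ => (j:ℝ) / n) (n := n) (fun k _ => hφ.intervalIntegrable _ _)
  simp only [Nat.cast_zero, zero_div, div_self hn'.ne'] at hsum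
  rw [← hsum, Finset.sum_div, ← Finset.sum_sub_distrib]
  have hterm : ∀ j ∈ Finset.range n,
      |φ (j / n) / n - ∫ x in ((j:ℝ) / n)..((j + 1 : ℕ) : ℝ) / n, φ x| ≤ ε / n := by
    intro j hj
    have hjn : (j:ℝ) + 1 ≤ n := by exact_mod_cast Finset.mem_range.1 hj
    have hj0 : (0:ℝ) ≤ j := j.cast_nonneg
    have hlen : ((j + 1 : ℕ) : ℝ) / n - j / n = 1 / n := by push_cast; ring
    have hle : (j:ℝ) / n ≤ ((j + 1 : ℕ) : ℝ) / n := by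
      have : (0:ℝ) < 1 / n := by positivity
      linarith
    have h1 : φ (j / n) / n = ∫ _ in ((j:ℝ) / n)..((j + 1 : ℕ) : ℝ) / n, φ (j / n) := by
      rw [intervalIntegral.integral_const, hlen, smul_eq_mul]; ring
    rw [h1, ← intervalIntegral.integral_sub (by simp) (hφ.intervalIntegrable _ _)]
    have hj1 : ((j + 1 : ℕ) : ℝ) / n ≤ 1 := by rw [div_le_one hn']; exact_mod_cast hjn
    have hj2 : (0:ℝ) ≤ j / n := by positivity
    have h2 := intervalIntegral.norm_integral_le_of_norm_le_const
      (f := fun x => φ (j / n) - φ x) (C := ε) (a := (j:ℝ) / n) (b := ((j + 1 : ℕ) : ℝ) / n)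
      (fun x hx => by
        rw [uIoc_of_le hle] at hx
        refine h _ ⟨hj2, hle.trans hj1⟩ _ ⟨hj2.trans hx.1.le, hx.2.trans hj1⟩ ?_
        rw [abs_sub_comm, abs_of_nonneg (by linarith [hx.1])]
        linarith [hx.2])
    rw [hlen, abs_of_pos (by positivity)] at h2
    simpa [div_eq_mul_inv] using h2
  calc _ ≤ ∑ j ∈ Finset.range n, |φ (j / n) / n -
        ∫ x in ((j:ℝ) / n)..((j + 1 : ℕ) : ℝ) / n, φ x| := Finset.abs_sum_le_sum_abs _ _
    _ ≤ ∑ j ∈ Finset.range n, ε / n := Finset.sum_le_sum hterm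
    _ = ε := by rw [Finset.sum_const, Finset.card_range, nsmul_eq_mul]; field_simp

/-- The average of `ψ` over the grid `{(j/n, k/n) | 0 ≤ j, k < n}`. -/
noncomputable def gridMean (n : ℕ) (ψ : ℝ → ℝ → ℝ) : ℝ :=
  (∑ j ∈ Finset.range n, (∑ k ∈ Finset.range n, ψ (j / n) (k / n)) / n) / n

theorem natCast_div_mem_Icc {n j : ℕ} (hj : j ∈ Finset.range n) : (j / n : ℝ) ∈ Icc (0:ℝ) 1 :=
  ⟨by positivity, div_le_one_of_le₀ (by exact_mod_cast (Finset.mem_range.1 hj).le) n.cast_nonneg⟩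

theorem gridMean_mono {n : ℕ} {ψ χ : ℝ → ℝ → ℝ}
    (h : ∀ u ∈ Icc (0:ℝ) 1, ∀ v ∈ Icc (0:ℝ) 1, ψ u v ≤ χ u v) : gridMean n ψ ≤ gridMean n χ := by
  unfold gridMean
  gcongr with j hj k hk
  exact h _ (natCast_div_mem_Icc hj) _ (natCast_div_mem_Icc hk)

theorem gridMean_sub (n : ℕ) (ψ χ : ℝ → ℝ → ℝ) :
    gridMean n (fun u v => ψ u v - χ u v) = gridMean n ψ - gridMean n χ := by
  simp only [gridMean, Finset.sum_sub_distrib, sub_div]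

theorem gridMean_const_mul (n : ℕ) (c : ℝ) (ψ : ℝ → ℝ → ℝ) :
    gridMean n (fun u v => c * ψ u v) = c * gridMean n ψ := by
  simp only [gridMean, ← Finset.mul_sum, mul_div_assoc]

theorem gridMean_const {n : ℕ} (hn : 0 < n) (c : ℝ) : gridMean n (fun _ _ => c) = c := by
  have hn' : (n:ℝ) ≠ 0 := by exact_mod_cast hn.ne'
  simp only [gridMean, Finset.sum_const, Finset.card_range, nsmul_eq_mul]
  field_simp

theorem abs_gridMean_sub_le {n : ℕ} {ψ χ w : ℝ → ℝ → ℝ}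
    (h : ∀ u ∈ Icc (0:ℝ) 1, ∀ v ∈ Icc (0:ℝ) 1, |ψ u v - χ u v| ≤ w u v) :
    |gridMean n ψ - gridMean n χ| ≤ gridMean n w := by
  rw [← gridMean_sub, abs_le]
  constructor
  · have h1 := gridMean_mono (n := n) (ψ := fun u v => -1 * w u v)
      (χ := fun u v => ψ u v - χ u v)
      fun u hu v hv => by linarith [(abs_le.1 (h u hu v hv)).1]
    rw [gridMean_const_mul] at h1
    linarith
  · exact gridMean_mono fun u hu v hv => (abs_le.1 (h u hu v hv)).2

open Filter Topology in
theorem tendsto_gridMean {ψ : ℝ → ℝ → ℝ} (hψ : Continuous (Function.uncurry ψ)) :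
    Tendsto (fun n => gridMean n ψ) atTop (𝓝 (∫ u in (0:ℝ)..1, ∫ v in (0:ℝ)..1, ψ u v)) := by
  rw [Metric.tendsto_atTop]
  intro ε hε
  have huc := ((isCompact_Icc (a := (0:ℝ)) (b := 1)).prod
    (isCompact_Icc (a := (0:ℝ)) (b := 1))).uniformContinuousOn_of_continuous hψ.continuousOn
  obtain ⟨δ, hδ, hd⟩ := Metric.uniformContinuousOn_iff.1 huc (ε / 3) (by positivity)
  obtain ⟨n₀, hn₀⟩ := exists_nat_one_div_lt hδ
  have hin : Continuous fun u => ∫ v in (0:ℝ)..1, ψ u v :=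
    intervalIntegral.continuous_parametric_intervalIntegral_of_continuous' hψ 0 1
  refine ⟨n₀ + 1, fun n hn => ?_⟩
  have hn0 : 0 < n := by omega
  have hn' : (0:ℝ) < n := by exact_mod_cast hn0
  have hnδ : 1 / (n:ℝ) < δ := by
    refine lt_of_le_of_lt ?_ hn₀
    have : ((n₀ : ℝ) + 1) ≤ n := by exact_mod_cast hn
    gcongr
  have hv : ∀ u ∈ Icc (0:ℝ) 1,
      |(∑ k ∈ Finset.range n, ψ u (k / n)) / n - ∫ v in (0:ℝ)..1, ψ u v| ≤ ε / 3 := fun u hu =>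
    abs_sum_div_sub_integral_le (hψ.comp (Continuous.prodMk_right u)) hn0 fun x hx y hy hxy =>
      (hd (u, x) ⟨hu, hx⟩ (u, y) ⟨hu, hy⟩ (by
        simpa [Prod.dist_eq, Real.dist_eq, hδ] using hxy.trans_lt hnδ)).le
  have hu := abs_sum_div_sub_integral_le (ε := ε / 3) hin hn0 fun x hx y hy hxy => by
    have hi : ∀ u, IntervalIntegrable (ψ u) volume 0 1 := fun u =>
      (hψ.comp (Continuous.prodMk_right u)).intervalIntegrable _ _
    rw [← intervalIntegral.integral_sub (hi x) (hi y)]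
    have := intervalIntegral.norm_integral_le_of_norm_le_const
      (f := fun v => ψ x v - ψ y v) (C := ε / 3) (a := 0) (b := 1)
      (fun v hv => by
        rw [uIoc_of_le zero_le_one] at hv
        exact (hd (x, v) ⟨hx, Ioc_subset_Icc_self hv⟩ (y, v) ⟨hy, Ioc_subset_Icc_self hv⟩ (by
          simpa [Prod.dist_eq, Real.dist_eq, hδ] using hxy.trans_lt hnδ)).le)
    simpa using this
  have hdiff : |gridMean n ψ - (∑ j ∈ Finset.range n, ∫ v in (0:ℝ)..1, ψ (j / n) v) / n|
      ≤ ε / 3 := by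
    rw [gridMean, ← sub_div, ← Finset.sum_sub_distrib, abs_div, abs_of_pos hn', div_le_iff₀ hn']
    calc _ ≤ ∑ j ∈ Finset.range n, |(∑ k ∈ Finset.range n, ψ (j / n) (k / n)) / n -
          ∫ v in (0:ℝ)..1, ψ (j / n) v| := Finset.abs_sum_le_sum_abs _ _
      _ ≤ ∑ j ∈ Finset.range n, ε / 3 :=
        Finset.sum_le_sum fun j hj => hv _ (natCast_div_mem_Icc hj)
      _ = ε / 3 * n := by rw [Finset.sum_const, Finset.card_range, nsmul_eq_mul, mul_comm]
  rw [Real.dist_eq]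
  have := abs_sub_le (gridMean n ψ)
    ((∑ j ∈ Finset.range n, ∫ v in (0:ℝ)..1, ψ (j / n) v) / n)
    (∫ u in (0:ℝ)..1, ∫ v in (0:ℝ)..1, ψ u v)
  linarith

/-- Solutions of `H f = f` for the discretized Lyapunov operator, with estimates uniform in the
mesh of the discretization. -/
theorem exists_gridMean_fixedPoint {k : ℝ → ℝ → ℝ → ℝ} {m M : ℝ} (hm : 0 < m)
    (hmk : ∀ t u v, m ≤ k t u v) (hkM : ∀ t u v, k t u v ≤ M) {n : ℕ} (hn : 0 < n) :
    ∃ f : ℝ → ℝ, (∀ t, f t ∈ Icc (m / M) (M / m)) ∧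
      (∀ s t ε, (∀ u v, |k s u v - k t u v| ≤ ε) → |f s - f t| ≤ ε / m) ∧
      ∀ t, gridMean n (fun u v => k t u v * f u * f v) =
        f t * gridMean n (fun u v => k 0 u v * f u * f v) := by
  have hM : 0 < M := hm.trans_le ((hmk 0 0 0).trans (hkM 0 0 0))
  have hn' : (0:ℝ) < n := by exact_mod_cast hn
  have : Nonempty (Fin n) := ⟨⟨0, hn⟩⟩
  obtain ⟨z, hz, c, hc, hzc⟩ := exists_pos_eigenvector_of_quadratic_pos
    (fun i j l : Fin n => k (i / n) (j / n) (l / n)) (fun i j l => hm.trans_le (hmk _ _ _))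
  set S : ℝ := ∑ j : Fin n, ∑ l : Fin n, z j * z l with hS
  set A : ℝ → ℝ := fun t => ∑ j : Fin n, ∑ l : Fin n, k t (j / n) (l / n) * z j * z l with hA
  have hSpos : 0 < S := Finset.sum_pos (fun j _ => Finset.sum_pos
    (fun l _ => mul_pos (hz j) (hz l)) Finset.univ_nonempty) Finset.univ_nonempty
  have hmA : ∀ t, m * S ≤ A t := fun t => by
    simp only [hS, hA, Finset.mul_sum, mul_assoc]
    gcongr with j _ l _
    · exact (mul_pos (hz j) (hz l)).le
    · exact hmk _ _ _
  have hAM : ∀ t, A t ≤ M * S := fun t => by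
    simp only [hS, hA, Finset.mul_sum, mul_assoc]
    gcongr with j _ l _
    · exact (mul_pos (hz j) (hz l)).le
    · exact hkM _ _ _
  have hmS : 0 < m * S := mul_pos hm hSpos
  have hApos : ∀ t, 0 < A t := fun t => hmS.trans_le (hmA t)
  have hnode : ∀ i : Fin n, A (i / n) = z i / c := fun i => by
    rw [eq_div_iff hc.ne', mul_comm]; exact (hzc i).symm
  have hgrid : ∀ t, gridMean n (fun u v => k t u v * (A u / A 0) * (A v / A 0)) =
      A t / (c * A 0 * n) ^ 2 := by
    intro t
    have hAt : ∀ X, A t / X = ∑ j : Fin n, ∑ l : Fin n,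
        k t (j / n) (l / n) * z j * z l / X := fun X => by simp only [hA, Finset.sum_div]
    rw [hAt]
    simp only [gridMean, Finset.sum_range, hnode, Finset.sum_div]
    refine Finset.sum_congr rfl fun j _ => Finset.sum_congr rfl fun l _ => ?_
    have := (hApos 0).ne'
    field_simp
  refine ⟨fun t => A t / A 0, fun t => ⟨?_, ?_⟩, fun s t ε h => ?_, fun t => ?_⟩
  · rw [div_le_div_iff₀ hM (hApos 0)]
    nlinarith [mul_le_mul_of_nonneg_left (hmA t) hM.le, mul_le_mul_of_nonneg_left (hAM 0) hm.le]
  · rw [div_le_div_iff₀ (hApos 0) hm]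
    nlinarith [mul_le_mul_of_nonneg_left (hmA 0) hM.le, mul_le_mul_of_nonneg_left (hAM t) hm.le]
  · have hε : 0 ≤ ε := (abs_nonneg _).trans (h 0 0)
    have h1 : |A s - A t| ≤ ε * S := by
      simp only [hS, hA, Finset.mul_sum, ← Finset.sum_sub_distrib]
      refine (Finset.abs_sum_le_sum_abs _ _).trans (Finset.sum_le_sum fun j _ =>
        (Finset.abs_sum_le_sum_abs _ _).trans (Finset.sum_le_sum fun l _ => ?_))
      rw [mul_assoc, mul_assoc, ← sub_mul, abs_mul, abs_of_pos (mul_pos (hz j) (hz l))]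
      exact mul_le_mul_of_nonneg_right (h _ _) (mul_pos (hz j) (hz l)).le
    rw [← sub_div, abs_div, abs_of_pos (hApos 0), div_le_div_iff₀ (hApos 0) hm]
    nlinarith [mul_le_mul_of_nonneg_left (hmA 0) hε, mul_le_mul_of_nonneg_right h1 hm.le]
  · rw [hgrid, hgrid, div_mul_div_comm, mul_comm (A 0), mul_div_mul_right _ _ (hApos 0).ne']

open Filter Topology BoundedContinuousFunction in
theorem exists_lyap_eq_mul_lyap_zero {k : ℝ → ℝ → ℝ → ℝ} {m M : ℝ} (hm : 0 < m)
    (hk : Continuous fun p : ℝ × ℝ × ℝ => k p.1 p.2.1 p.2.2)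
    (hmk : ∀ t u v, m ≤ k t u v) (hkM : ∀ t u v, k t u v ≤ M)
    (hunif : ∀ ε > 0, ∃ δ > 0, ∀ s t, |s - t| < δ → ∀ u v, |k s u v - k t u v| ≤ ε) :
    ∃ f : ℝ → ℝ, Continuous f ∧ (∀ t, m / M ≤ f t) ∧
      ∀ t ∈ Icc (0:ℝ) 1, lyap k f t = f t * lyap k f 0 := by
  have hM : 0 < M := hm.trans_le ((hmk 0 0 0).trans (hkM 0 0 0))
  choose F hFmem hFmod hFfix using fun n : ℕ => exists_gridMean_fixedPoint hm hmk hkM n.succ_pos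
  have hFunif : ∀ ε > 0, ∃ δ > 0, ∀ s t, |s - t| < δ → ∀ n, |F n s - F n t| < ε := by
    intro ε hε
    obtain ⟨δ, hδ, h⟩ := hunif (ε * m / 2) (by positivity)
    refine ⟨δ, hδ, fun s t hst n => (hFmod n s t _ (h s t hst)).trans_lt ?_⟩
    rw [div_lt_iff₀ hm]
    linarith [mul_pos hε hm]
  have hFc : ∀ n, Continuous (F n) := fun n => Metric.continuous_iff.2 fun t ε hε => by
    obtain ⟨δ, hδ, h⟩ := hFunif ε hε
    exact ⟨δ, hδ, fun s hs => h s t hs n⟩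
  let G : ℕ → Icc (0:ℝ) 1 →ᵇ ℝ := fun n =>
    mkOfCompact ⟨fun t => F n t, (hFc n).comp continuous_subtype_val⟩
  have hcomp : IsCompact (closure (range G)) := by
    refine arzela_ascoli (Icc (m / M) (M / m)) isCompact_Icc _ ?_ ?_
    · rintro _ t ⟨n, rfl⟩
      exact hFmem n t
    · intro t
      rw [Metric.equicontinuousAt_iff]
      intro ε hε
      obtain ⟨δ, hδ, h⟩ := hFunif ε hε
      refine ⟨δ, hδ, ?_⟩
      rintro s hs ⟨_, n, rfl⟩
      rw [dist_comm]
      exact h s t hs n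
  obtain ⟨g, -, φ, hφ, hlim⟩ := hcomp.tendsto_subseq fun n =>
    subset_closure (mem_range_self (f := G) n)
  have hgc := g.continuous
  let f : ℝ → ℝ := IccExtend zero_le_one g
  have hfc : Continuous f := hgc.Icc_extend'
  have hfg : ∀ t (ht : t ∈ Icc (0:ℝ) 1), f t = g ⟨t, ht⟩ := fun t ht =>
    IccExtend_of_mem _ _ ht
  have hdist : ∀ n, ∀ t ∈ Icc (0:ℝ) 1, |F (φ n) t - f t| ≤ dist (G (φ n)) g := by
    intro n t ht
    rw [hfg t ht]
    exact dist_coe_le_dist (f := G (φ n)) (g := g) ⟨t, ht⟩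
  have hd0 : Tendsto (fun n => dist (G (φ n)) g) atTop (𝓝 0) := tendsto_iff_dist_tendsto_zero.1 hlim
  have hpt : ∀ t ∈ Icc (0:ℝ) 1, Tendsto (fun n => F (φ n) t) atTop (𝓝 (f t)) := fun t ht => by
    rw [tendsto_iff_dist_tendsto_zero]
    exact squeeze_zero (fun _ => dist_nonneg) (fun n => hdist n t ht) hd0
  have hfmem : ∀ t ∈ Icc (0:ℝ) 1, f t ∈ Icc (m / M) (M / m) := fun t ht =>
    isClosed_Icc.mem_of_tendsto (hpt t ht) (Eventually.of_forall fun n => hFmem (φ n) t)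
  have hgrid : ∀ t, Tendsto
      (fun n => gridMean (φ n).succ fun u v => k t u v * F (φ n) u * F (φ n) v) atTop
      (𝓝 (lyap k f t)) := by
    intro t
    have hc : Continuous (Function.uncurry fun u v => k t u v * f u * f v) := by
      have h1 : Continuous fun p : ℝ × ℝ => k t p.1 p.2 :=
        hk.comp (continuous_const.prodMk continuous_id)
      exact (h1.mul (hfc.comp continuous_fst)).mul (hfc.comp continuous_snd)
    have hclose : ∀ n, |gridMean (φ n).succ (fun u v => k t u v * F (φ n) u * F (φ n) v) -
        gridMean (φ n).succ (fun u v => k t u v * f u * f v)| ≤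
        M * (2 * (M / m)) * dist (G (φ n)) g := by
      intro n
      rw [← gridMean_const (φ n).succ_pos (M * (2 * (M / m)) * dist (G (φ n)) g)]
      refine abs_gridMean_sub_le fun u hu v hv => ?_
      have e1 := hdist n u hu
      have e2 := hdist n v hv
      set d := dist (G (φ n)) g
      have hd : 0 ≤ d := dist_nonneg
      have b1 : |F (φ n) v| ≤ M / m := by
        rw [abs_of_nonneg (le_trans (by positivity) (hFmem (φ n) v).1)]
        exact (hFmem (φ n) v).2
      have b2 : |f u| ≤ M / m := by
        rw [abs_of_nonneg (le_trans (by positivity) (hfmem u hu).1)]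
        exact (hfmem u hu).2
      have b3 : |k t u v| ≤ M := by
        rw [abs_of_nonneg (hm.le.trans (hmk t u v))]
        exact hkM t u v
      calc |k t u v * F (φ n) u * F (φ n) v - k t u v * f u * f v|
          = |k t u v| * |(F (φ n) u - f u) * F (φ n) v + f u * (F (φ n) v - f v)| := by
            rw [← abs_mul]; congr 1; ring
        _ ≤ M * (d * (M / m) + M / m * d) := by
            have := abs_add_le ((F (φ n) u - f u) * F (φ n) v) (f u * (F (φ n) v - f v))
            rw [abs_mul, abs_mul] at this
            gcongr
            refine this.trans ?_
            gcongr
        _ = M * (2 * (M / m)) * d := by ring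
    have h1 : Tendsto (fun n => gridMean (φ n).succ fun u v => k t u v * f u * f v) atTop
        (𝓝 (lyap k f t)) :=
      (tendsto_gridMean hc).comp ((tendsto_add_atTop_nat 1).comp hφ.tendsto_atTop)
    have h2 := squeeze_zero (fun _ => abs_nonneg _) hclose
      (by simpa using hd0.const_mul (M * (2 * (M / m))))
    simpa using ((tendsto_zero_iff_abs_tendsto_zero _).2 h2).add h1
  refine ⟨f, hfc, fun t => ?_, fun t ht => ?_⟩
  · have := (hfmem _ (projIcc (0:ℝ) 1 zero_le_one t).2).1
    rwa [hfg _ (projIcc (0:ℝ) 1 zero_le_one t).2] at this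
  · refine tendsto_nhds_unique (hgrid t) ?_
    simp_rw [hFfix (φ _) t]
    exact (hpt t ht).mul (hgrid 0)

theorem lyap_pos {k : ℝ → ℝ → ℝ → ℝ} (hk : Continuous fun p : ℝ × ℝ × ℝ => k p.1 p.2.1 p.2.2)
    (hk0 : ∀ t u v, 0 < k t u v) {f : ℝ → ℝ} (hf : Continuous f) (hf0 : ∀ t, 0 < f t) (t : ℝ) :
    0 < lyap k f t := by
  have hc : Continuous (Function.uncurry fun u v => k t u v * f u * f v) := by
    have h1 : Continuous fun p : ℝ × ℝ => k t p.1 p.2 :=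
      hk.comp (continuous_const.prodMk continuous_id)
    exact (h1.mul (hf.comp continuous_fst)).mul (hf.comp continuous_snd)
  refine intervalIntegral.intervalIntegral_pos_of_pos
    ((intervalIntegral.continuous_parametric_intervalIntegral_of_continuous'
      hc 0 1).intervalIntegrable _ _) (fun u => ?_) zero_lt_one
  have hcu : Continuous fun v => k t u v * f u * f v := hc.comp (Continuous.prodMk_right u)
  exact intervalIntegral.intervalIntegral_pos_of_pos (hcu.intervalIntegrable _ _)
    (fun v => mul_pos (mul_pos (hk0 t u v) (hf0 u)) (hf0 v)) zero_lt_one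

/-- The equation `H f = f`, i.e. `(L f)(t)/(L f)(0) = f(t)` on `[0,1]`, has at least one
nontrivial nonnegative continuous solution. -/
theorem hfix_exists
    (K : ℝ → ℝ → ℝ → ℝ)
    (hK : ContinuousOn (fun p : ℝ × ℝ × ℝ => K p.1 p.2.1 p.2.2)
      ((Set.Icc 0 1) ×ˢ (Set.Icc 0 1) ×ˢ (Set.Icc 0 1)))
    (hKpos : ∀ t ∈ Set.Icc (0:ℝ) 1, ∀ u ∈ Set.Icc (0:ℝ) 1, ∀ v ∈ Set.Icc (0:ℝ) 1,
      0 < K t u v)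
    :
    ∃ f : ℝ → ℝ, ContinuousOn f (Set.Icc 0 1) ∧
      (∀ t ∈ Set.Icc (0:ℝ) 1, 0 ≤ f t) ∧
      (∃ t ∈ Set.Icc (0:ℝ) 1, f t ≠ 0) ∧
      (∀ t ∈ Set.Icc (0:ℝ) 1, lyap K f t / lyap K f 0 = f t) := by
  set P : ℝ → ℝ := fun t => projIcc (0:ℝ) 1 zero_le_one t with hP
  have hPmem : ∀ t, P t ∈ Icc (0:ℝ) 1 := fun t => (projIcc (0:ℝ) 1 zero_le_one t).2
  have hPc : Continuous P := continuous_subtype_val.comp continuous_projIcc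
  have hPid : ∀ t ∈ Icc (0:ℝ) 1, P t = t := fun t ht => by simp [hP, projIcc_of_mem _ ht]
  have hPdist : ∀ s t, dist (P s) (P t) ≤ dist s t := fun s t => by
    simpa [hP, Subtype.dist_eq] using (LipschitzWith.projIcc (zero_le_one (α := ℝ))).dist_le_mul s t
  have hcube : IsCompact ((Icc (0:ℝ) 1) ×ˢ (Icc (0:ℝ) 1) ×ˢ (Icc (0:ℝ) 1)) :=
    isCompact_Icc.prod (isCompact_Icc.prod isCompact_Icc)
  have hne : ((Icc (0:ℝ) 1) ×ˢ (Icc (0:ℝ) 1) ×ˢ (Icc (0:ℝ) 1)).Nonempty :=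
    ⟨(0, 0, 0), by simp⟩
  have hPPP : ∀ t u v, (P t, P u, P v) ∈ (Icc (0:ℝ) 1) ×ˢ (Icc (0:ℝ) 1) ×ˢ (Icc (0:ℝ) 1) :=
    fun t u v => ⟨hPmem t, hPmem u, hPmem v⟩
  obtain ⟨p, hp, hmin⟩ := hcube.exists_isMinOn hne hK
  obtain ⟨q, -, hmax⟩ := hcube.exists_isMaxOn hne hK
  have hm : 0 < K p.1 p.2.1 p.2.2 := hKpos _ hp.1 _ hp.2.1 _ hp.2.2
  set k : ℝ → ℝ → ℝ → ℝ := fun t u v => K (P t) (P u) (P v) with hk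
  have hkc : Continuous fun p : ℝ × ℝ × ℝ => k p.1 p.2.1 p.2.2 :=
    hK.comp_continuous (f := fun p : ℝ × ℝ × ℝ => (P p.1, P p.2.1, P p.2.2)) (by fun_prop)
      fun p => hPPP _ _ _
  have hkmin : ∀ t u v, K p.1 p.2.1 p.2.2 ≤ k t u v := fun t u v => hmin (hPPP t u v)
  have hkmax : ∀ t u v, k t u v ≤ K q.1 q.2.1 q.2.2 := fun t u v => hmax (hPPP t u v)
  have hunif : ∀ ε > 0, ∃ δ > 0, ∀ s t, |s - t| < δ → ∀ u v, |k s u v - k t u v| ≤ ε := by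
    intro ε hε
    obtain ⟨δ, hδ, h⟩ :=
      Metric.uniformContinuousOn_iff.1 (hcube.uniformContinuousOn_of_continuous hK) ε hε
    refine ⟨δ, hδ, fun s t hst u v => (h _ (hPPP s u v) _ (hPPP t u v) ?_).le⟩
    simpa [Prod.dist_eq, hδ] using (hPdist s t).trans_lt hst
  obtain ⟨f, hfc, hfm, hfix⟩ := exists_lyap_eq_mul_lyap_zero hm hkc hkmin hkmax hunif
  have hf0 : ∀ t, 0 < f t := fun t =>
    (div_pos hm (hm.trans_le (hkmin 0 0 0 |>.trans (hkmax 0 0 0)))).trans_le (hfm t)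
  have hlyap : ∀ t ∈ Icc (0:ℝ) 1, lyap K f t = lyap k f t := by
    intro t ht
    refine intervalIntegral.integral_congr fun u hu => intervalIntegral.integral_congr fun v hv => ?_
    rw [uIcc_of_le zero_le_one] at hu hv
    simp only [hk, hPid t ht, hPid u hu, hPid v hv]
  have h0 : (0:ℝ) ∈ Icc (0:ℝ) 1 := ⟨le_rfl, zero_le_one⟩
  refine ⟨f, hfc.continuousOn, fun t _ => (hf0 t).le, ⟨0, h0, (hf0 0).ne'⟩, fun t ht => ?_⟩
  rw [hlyap t ht, hlyap 0 h0, hfix t ht]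
  exact mul_div_cancel_right₀ _
    (lyap_pos hkc (fun t u v => hm.trans_le (hkmin t u v)) hfc hf0 0).ne'
end

section
/- Suppose the kernel K satisfies max_{(t,u,v)∈[0,1]³} K(t,u,v) < c · min_{(t,u,v)∈[0,1]³} K(t,u,v) for some constant c with 1 < c < (1/2)·√(√17 + 1). Then the Lyapunov operator L has exactly one fixed point in C₀⁺[0,1]; i.e., there is a unique nontrivial nonnegative continuous function g on [0,1] with Lg = g. -/
open MeasureTheory Set

section QuadraticIntegralOperator

lemma integrable_of_continuous_of_compactSpace {Y : Type*} [TopologicalSpace Y] [CompactSpace Y]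
    [MeasurableSpace Y] [OpensMeasurableSpace Y] {ν : Measure Y} [IsFiniteMeasure ν]
    {f : Y → ℝ} (hf : Continuous f) : Integrable f ν :=
  hf.integrable_of_hasCompactSupport (HasCompactSupport.of_compactSpace f)

variable {X : Type*} [TopologicalSpace X] [CompactSpace X] [MeasurableSpace X] [BorelSpace X]

lemma integral_mem_Icc_of_forall (μ : Measure X) [IsProbabilityMeasure μ] {f : C(X, ℝ)} {a b : ℝ}
    (h : ∀ t, f t ∈ Icc a b) : ∫ u, f u ∂μ ∈ Icc a b := by
  have hf : Integrable f μ := integrable_of_continuous_of_compactSpace f.continuous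
  constructor
  · simpa using integral_mono (integrable_const a) hf fun t => (h t).1
  · simpa using integral_mono hf (integrable_const b) fun t => (h t).2

/-- The continuous probability densities with respect to `μ`. -/
def probDensities (μ : Measure X) : Set C(X, ℝ) :=
  {f | (∀ t, 0 ≤ f t) ∧ ∫ u, f u ∂μ = 1}

lemma isClosed_probDensities (μ : Measure X) [IsFiniteMeasure μ] :
    IsClosed (probDensities μ) := by
  refine IsClosed.inter (s₁ := {f : C(X, ℝ) | ∀ t, 0 ≤ f t}) ?_ ?_
  · rw [ofPred_forall]
    exact isClosed_iInter fun t => isClosed_le continuous_const (continuous_eval_const t)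
  · refine isClosed_eq (f := fun f : C(X, ℝ) => ∫ u, f u ∂μ) ?_ continuous_const
    refine (LipschitzWith.of_dist_le_mul (K := (μ.real univ).toNNReal) fun f g => ?_).continuous
    rw [Real.coe_toNNReal _ measureReal_nonneg, dist_eq_norm, mul_comm,
      ← integral_sub (integrable_of_continuous_of_compactSpace f.continuous)
        (integrable_of_continuous_of_compactSpace g.continuous)]
    refine norm_integral_le_of_norm_le_const (Filter.Eventually.of_forall fun u => ?_)
    rw [← dist_eq_norm]
    exact ContinuousMap.dist_apply_le_dist u

variable [T2Space X] [SecondCountableTopology X]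

/-- The quadratic integral operator `f ↦ ∫ k(t, p) f(p.1) f(p.2) d(μ × μ)(p)` with a continuous
kernel on a compact space. -/
noncomputable def quadOp (μ : Measure X) [IsFiniteMeasure μ] (k : C(X × X × X, ℝ)) (f : C(X, ℝ)) :
    C(X, ℝ) where
  toFun t := ∫ p, k (t, p) * (f p.1 * f p.2) ∂(μ.prod μ)
  continuous_toFun := by
    have h := continuous_parametric_integral_of_continuous (μ := μ.prod μ) (s := univ)
      (f := fun (t : X) (p : X × X) => k (t, p) * (f p.1 * f p.2))
      (by unfold Function.uncurry; fun_prop) isCompact_univ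
    simpa using h

lemma quadOp_apply (μ : Measure X) [IsFiniteMeasure μ] (k : C(X × X × X, ℝ)) (f : C(X, ℝ)) (t : X) :
    quadOp μ k f t = ∫ p, k (t, p) * (f p.1 * f p.2) ∂(μ.prod μ) := rfl

lemma quadOp_smul (μ : Measure X) [IsFiniteMeasure μ] (k : C(X × X × X, ℝ)) (r : ℝ) (f : C(X, ℝ)) :
    quadOp μ k (r • f) = r ^ 2 • quadOp μ k f := by
  ext t
  simp only [quadOp_apply, ContinuousMap.smul_apply, smul_eq_mul]
  rw [← integral_const_mul]
  congr 1 with p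
  ring

lemma quadOp_mem_Icc (μ : Measure X) [IsFiniteMeasure μ] {k : C(X × X × X, ℝ)} {m M : ℝ}
    (hm : ∀ q, m ≤ k q) (hM : ∀ q, k q ≤ M) {f : C(X, ℝ)} (hf : ∀ t, 0 ≤ f t) (t : X) :
    quadOp μ k f t ∈ Icc (m * (∫ u, f u ∂μ) ^ 2) (M * (∫ u, f u ∂μ) ^ 2) := by
  have h : (∫ u, f u ∂μ) ^ 2 = ∫ p, f p.1 * f p.2 ∂(μ.prod μ) := by
    rw [integral_prod_mul, sq]
  rw [quadOp_apply, h, ← integral_const_mul, ← integral_const_mul]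
  constructor
  · refine integral_mono (integrable_of_continuous_of_compactSpace (by fun_prop))
      (integrable_of_continuous_of_compactSpace (by fun_prop)) fun p => ?_
    exact mul_le_mul_of_nonneg_right (hm _) (mul_nonneg (hf _) (hf _))
  · refine integral_mono (integrable_of_continuous_of_compactSpace (by fun_prop))
      (integrable_of_continuous_of_compactSpace (by fun_prop)) fun p => ?_
    exact mul_le_mul_of_nonneg_right (hM _) (mul_nonneg (hf _) (hf _))

/-- On probability densities, the oscillation of the kernel controls the Lipschitz constant. -/
lemma abs_quadOp_sub_le (μ : Measure X) [IsProbabilityMeasure μ] {k : C(X × X × X, ℝ)} {m M : ℝ}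
    (hm : ∀ q, m ≤ k q) (hM : ∀ q, k q ≤ M) {f g : C(X, ℝ)} (hf : ∀ t, 0 ≤ f t)
    (hg : ∀ t, 0 ≤ g t) (hf1 : ∫ u, f u ∂μ = 1) (hg1 : ∫ u, g u ∂μ = 1) (t : X) :
    |quadOp μ k f t - quadOp μ k g t| ≤ 2 * (M - m) * dist f g := by
  have hprod : ∀ h : C(X, ℝ), ∫ u, h u ∂μ = 1 → ∫ p, h p.1 * h p.2 ∂(μ.prod μ) = 1 := by
    intro h h1
    rw [integral_prod_mul, h1, mul_one]
  have hint : ∀ {F : X × X → ℝ}, Continuous F → Integrable F (μ.prod μ) :=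
    fun hF => integrable_of_continuous_of_compactSpace hF
  have hfst : ∫ p, f p.1 ∂(μ.prod μ) = 1 := by
    rw [integral_fun_fst]; simp [hf1]
  have hsnd : ∫ p, g p.2 ∂(μ.prod μ) = 1 := by
    rw [integral_fun_snd]; simp [hg1]
  have heq : quadOp μ k f t - quadOp μ k g t =
      ∫ p, (k (t, p) - m) * (f p.1 * f p.2 - g p.1 * g p.2) ∂(μ.prod μ) := by
    have : ∀ p : X × X, (k (t, p) - m) * (f p.1 * f p.2 - g p.1 * g p.2) =
        (k (t, p) * (f p.1 * f p.2) - k (t, p) * (g p.1 * g p.2)) -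
        m * (f p.1 * f p.2 - g p.1 * g p.2) := fun p => by ring
    simp_rw [this]
    rw [integral_sub (hint (by fun_prop)) (hint (by fun_prop)),
      integral_sub (hint (by fun_prop)) (hint (by fun_prop)), integral_const_mul,
      integral_sub (hint (by fun_prop)) (hint (by fun_prop)), hprod f hf1, hprod g hg1,
      quadOp_apply, quadOp_apply]
    ring
  have hbound : ∫ p, (M - m) * (dist f g * (f p.1 + g p.2)) ∂(μ.prod μ) =
      2 * (M - m) * dist f g := by
    rw [integral_const_mul, integral_const_mul,
      integral_add (hint (by fun_prop)) (hint (by fun_prop)), hfst, hsnd]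
    ring
  rw [heq, ← hbound, ← Real.norm_eq_abs]
  refine norm_integral_le_of_norm_le (hint (by fun_prop)) (Filter.Eventually.of_forall fun p => ?_)
  have hd : ∀ u, |f u - g u| ≤ dist f g := fun u => by
    simpa [Real.dist_eq] using ContinuousMap.dist_apply_le_dist (f := f) (g := g) u
  rw [Real.norm_eq_abs, abs_mul]
  refine mul_le_mul ?_ ?_ (abs_nonneg _) (by linarith [hm (t, p), hM (t, p)])
  · rw [abs_of_nonneg (by linarith [hm (t, p)])]
    linarith [hM (t, p)]
  · have h1 : f p.1 * f p.2 - g p.1 * g p.2 =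
        f p.1 * (f p.2 - g p.2) + g p.2 * (f p.1 - g p.1) := by ring
    rw [h1]
    refine (abs_add_le _ _).trans ?_
    rw [abs_mul, abs_mul, abs_of_nonneg (hf _), abs_of_nonneg (hg _), mul_add, mul_comm (dist f g),
      mul_comm (dist f g)]
    exact add_le_add (mul_le_mul_of_nonneg_left (hd _) (hf _))
      (mul_le_mul_of_nonneg_left (hd _) (hg _))

/-- The quadratic integral operator followed by normalization to total mass one. -/
noncomputable def normQuadOp (μ : Measure X) [IsFiniteMeasure μ] (k : C(X × X × X, ℝ))
    (f : C(X, ℝ)) : C(X, ℝ) :=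
  (∫ u, quadOp μ k f u ∂μ)⁻¹ • quadOp μ k f

lemma quadOp_mem_Icc_of_mem_probDensities {μ : Measure X} [IsFiniteMeasure μ]
    {k : C(X × X × X, ℝ)} {m M : ℝ} (hm : ∀ q, m ≤ k q) (hM : ∀ q, k q ≤ M) {f : C(X, ℝ)}
    (hf : f ∈ probDensities μ) (t : X) : quadOp μ k f t ∈ Icc m M := by
  simpa [hf.2] using quadOp_mem_Icc μ hm hM hf.1 t

lemma mapsTo_normQuadOp (μ : Measure X) [IsProbabilityMeasure μ] {k : C(X × X × X, ℝ)} {m M : ℝ}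
    (hm0 : 0 < m) (hm : ∀ q, m ≤ k q) (hM : ∀ q, k q ≤ M) :
    MapsTo (normQuadOp μ k) (probDensities μ) (probDensities μ) := by
  intro f hf
  have hL := quadOp_mem_Icc_of_mem_probDensities hm hM hf
  have ha := (integral_mem_Icc_of_forall μ hL).1
  refine ⟨fun t => ?_, ?_⟩
  · exact mul_nonneg (inv_nonneg.2 (hm0.le.trans ha)) (hm0.le.trans (hL t).1)
  · simp only [normQuadOp, ContinuousMap.smul_apply, smul_eq_mul]
    rw [integral_const_mul, inv_mul_cancel₀ (hm0.trans_le ha).ne']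

lemma dist_normQuadOp_le (μ : Measure X) [IsProbabilityMeasure μ] {k : C(X × X × X, ℝ)} {m M c : ℝ}
    (hm0 : 0 < m) (hm : ∀ q, m ≤ k q) (hM : ∀ q, k q ≤ M) (hMc : M ≤ c * m) (hc : 1 ≤ c)
    {f g : C(X, ℝ)} (hf : f ∈ probDensities μ) (hg : g ∈ probDensities μ) :
    dist (normQuadOp μ k f) (normQuadOp μ k g) ≤ 2 * (c ^ 2 - 1) * dist f g := by
  have hd := dist_nonneg (x := f) (y := g)
  refine (ContinuousMap.dist_le (mul_nonneg (by nlinarith) hd)).2 fun t => ?_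
  have hLf := quadOp_mem_Icc_of_mem_probDensities hm hM hf
  have hLg := quadOp_mem_Icc_of_mem_probDensities hm hM hg
  have ha := (integral_mem_Icc_of_forall μ hLf).1
  have hb := (integral_mem_Icc_of_forall μ hLg).1
  have hD := abs_quadOp_sub_le μ hm hM hf.1 hg.1 hf.2 hg.2
  have hD' : |(∫ u, quadOp μ k f u ∂μ) - ∫ u, quadOp μ k g u ∂μ| ≤ 2 * (M - m) * dist f g := by
    have := integral_mem_Icc_of_forall μ (f := quadOp μ k f - quadOp μ k g)
      (fun t => abs_le.1 (hD t))
    simp only [ContinuousMap.sub_apply] at this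
    rw [integral_sub (integrable_of_continuous_of_compactSpace (by fun_prop))
      (integrable_of_continuous_of_compactSpace (by fun_prop))] at this
    exact abs_le.2 this
  have hDt := hD t
  have hx := hLg t
  rw [Real.dist_eq]
  simp only [normQuadOp, ContinuousMap.smul_apply, smul_eq_mul]
  generalize (∫ u, quadOp μ k f u ∂μ) = a at *
  generalize (∫ u, quadOp μ k g u ∂μ) = b at *
  generalize quadOp μ k f t = x at *
  generalize quadOp μ k g t = y at *
  have ha0 : 0 < a := hm0.trans_le ha
  have hb0 : 0 < b := hm0.trans_le hb
  have hE : 2 * (M - m) * dist f g ≤ 2 * (c - 1) * dist f g * m := by nlinarith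
  have hE0 : 0 ≤ 2 * (c - 1) * dist f g := mul_nonneg (by linarith) hd
  have hE' : 2 * (M - m) * dist f g ≤ 2 * (c - 1) * dist f g * a :=
    hE.trans (mul_le_mul_of_nonneg_left ha hE0)
  have heq : a⁻¹ * x - b⁻¹ * y = (x - y) / a - (y / b) * ((a - b) / a) := by
    field_simp
    ring
  have h1 : |(x - y) / a| ≤ 2 * (c - 1) * dist f g := by
    rw [abs_div, abs_of_pos ha0, div_le_iff₀ ha0]
    exact hDt.trans hE'
  have h2 : |(a - b) / a| ≤ 2 * (c - 1) * dist f g := by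
    rw [abs_div, abs_of_pos ha0, div_le_iff₀ ha0]
    exact hD'.trans hE'
  have h3 : |y / b| ≤ c := by
    rw [abs_div, abs_of_pos hb0, div_le_iff₀ hb0, abs_of_nonneg (hm0.le.trans hx.1)]
    nlinarith [hx.2]
  rw [heq]
  calc _ ≤ |(x - y) / a| + |(y / b) * ((a - b) / a)| := abs_sub _ _
    _ ≤ 2 * (c - 1) * dist f g + c * (2 * (c - 1) * dist f g) := by
      rw [abs_mul]
      exact add_le_add h1 (mul_le_mul h3 h2 (abs_nonneg _) (by linarith))
    _ = _ := by ring

/-- A quadratic integral operator whose kernel has small relative oscillation has exactly one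
nonzero nonnegative fixed point. -/
theorem exists_unique_fixedPoint_quadOp (μ : Measure X) [IsProbabilityMeasure μ]
    {k : C(X × X × X, ℝ)} {m M c : ℝ} (hm0 : 0 < m) (hm : ∀ q, m ≤ k q) (hM : ∀ q, k q ≤ M)
    (hMc : M ≤ c * m) (hc : 1 ≤ c) (hc2 : c ^ 2 < 3 / 2) :
    ∃! g : C(X, ℝ), (∀ t, 0 ≤ g t) ∧ g ≠ 0 ∧ quadOp μ k g = g := by
  have hmaps := mapsTo_normQuadOp μ hm0 hm hM
  have hcontr : ContractingWith (2 * (c ^ 2 - 1)).toNNReal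
      (hmaps.restrict (normQuadOp μ k) (probDensities μ) (probDensities μ)) := by
    refine ⟨?_, LipschitzWith.of_dist_le_mul fun f g => ?_⟩
    · rw [← NNReal.coe_lt_coe, Real.coe_toNNReal _ (by nlinarith), NNReal.coe_one]
      linarith
    · rw [Real.coe_toNNReal _ (by nlinarith)]
      exact dist_normQuadOp_le μ hm0 hm hM hMc hc f.2 g.2
  have : CompleteSpace (probDensities μ) := (isClosed_probDensities μ).completeSpace_coe
  have : Nonempty (probDensities μ) := ⟨⟨1, by simp [probDensities]⟩⟩
  obtain ⟨⟨x, hx⟩, hxfix⟩ : ∃ x, Function.IsFixedPt (hmaps.restrict _ _ _) x :=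
    ⟨_, hcontr.fixedPoint_isFixedPt⟩
  have hxN : normQuadOp μ k x = x := congrArg Subtype.val hxfix
  have ha := (integral_mem_Icc_of_forall μ (quadOp_mem_Icc_of_mem_probDensities hm hM hx)).1
  unfold normQuadOp at hxN
  set a := ∫ u, quadOp μ k x u ∂μ with ha_def
  have ha0 : 0 < a := hm0.trans_le ha
  refine ⟨a⁻¹ • x, ⟨fun t => mul_nonneg (inv_nonneg.2 ha0.le) (hx.1 t), ?_, ?_⟩, ?_⟩
  · refine smul_ne_zero (inv_ne_zero ha0.ne') ?_
    rintro rfl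
    simpa using hx.2
  · rw [quadOp_smul, sq, mul_smul, hxN]
  · rintro g ⟨hg0, hgne, hgfix⟩
    have hs : 0 < ∫ u, g u ∂μ := by
      refine (integral_nonneg hg0).lt_of_ne' fun h0 => hgne ?_
      ext t
      have h := (quadOp_mem_Icc μ hm hM hg0 t).2
      rw [hgfix, h0] at h
      exact le_antisymm (by simpa using h) (hg0 t)
    set s := ∫ u, g u ∂μ with hs_def
    have hy : s⁻¹ • g ∈ probDensities μ := by
      refine ⟨fun t => mul_nonneg (inv_nonneg.2 hs.le) (hg0 t), ?_⟩
      simp only [ContinuousMap.smul_apply, smul_eq_mul]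
      rw [integral_const_mul, ← hs_def, inv_mul_cancel₀ hs.ne']
    have hLy : quadOp μ k (s⁻¹ • g) = s⁻¹ • s⁻¹ • g := by
      rw [quadOp_smul, hgfix, sq, mul_smul]
    have hint : ∫ u, quadOp μ k (s⁻¹ • g) u ∂μ = s⁻¹ := by
      rw [hLy]
      simp only [ContinuousMap.smul_apply _ (s⁻¹ • g), smul_eq_mul]
      rw [integral_const_mul, hy.2, mul_one]
    have hyfix : Function.IsFixedPt (hmaps.restrict _ _ _) ⟨s⁻¹ • g, hy⟩ := by
      refine Subtype.ext ?_
      change normQuadOp μ k (s⁻¹ • g) = s⁻¹ • g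
      rw [normQuadOp, hint, hLy, inv_inv, smul_inv_smul₀ hs.ne']
    have hxy : s⁻¹ • g = x := congrArg Subtype.val (hcontr.fixedPoint_unique' hyfix hxfix)
    have has : a = s⁻¹ := by rw [ha_def, ← hxy, hint]
    rw [has, inv_inv, ← hxy, smul_inv_smul₀ hs.ne']

end QuadraticIntegralOperator

lemma intervalIntegral_zero_one_eq_integral_unitInterval (f : ℝ → ℝ) :
    ∫ u in (0:ℝ)..1, f u = ∫ u : unitInterval, f u := by
  rw [intervalIntegral.integral_of_le zero_le_one, ← integral_Icc_eq_integral_Ioc]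
  exact (integral_subtype measurableSet_Icc f).symm

lemma lyap_eq_quadOp {K : ℝ → ℝ → ℝ → ℝ} {k : C(unitInterval × unitInterval × unitInterval, ℝ)}
    (hk : ∀ t u v : unitInterval, k (t, u, v) = K t u v) {f : ℝ → ℝ} {F : C(unitInterval, ℝ)}
    (hF : ∀ t : unitInterval, F t = f t) (t : unitInterval) :
    lyap K f t = quadOp volume k F t := by
  rw [quadOp_apply, integral_prod _ (integrable_of_continuous_of_compactSpace (by fun_prop)), lyap,
    intervalIntegral_zero_one_eq_integral_unitInterval]
  congr 1 with u
  rw [intervalIntegral_zero_one_eq_integral_unitInterval]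
  congr 1 with v
  rw [hk, hF, hF, mul_assoc]

/-- If `max K < c · min K` over `[0,1]³` for some `c` with
`1 < c < (1/2)·√(√17 + 1)`, then the Lyapunov operator `L` has exactly one fixed
point in `C₀⁺[0,1]` (uniqueness meaning equality of solutions on `[0,1]`). -/
theorem lyapfix_unique
    (K : ℝ → ℝ → ℝ → ℝ)
    (hK : ContinuousOn (fun p : ℝ × ℝ × ℝ => K p.1 p.2.1 p.2.2)
      ((Set.Icc 0 1) ×ˢ (Set.Icc 0 1) ×ˢ (Set.Icc 0 1)))
    (hKpos : ∀ t ∈ Set.Icc (0:ℝ) 1, ∀ u ∈ Set.Icc (0:ℝ) 1, ∀ v ∈ Set.Icc (0:ℝ) 1,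
      0 < K t u v)
    (Om om c : ℝ)
    (hOm : ∀ t ∈ Set.Icc (0:ℝ) 1, ∀ u ∈ Set.Icc (0:ℝ) 1, ∀ v ∈ Set.Icc (0:ℝ) 1,
      K t u v ≤ Om)
    (hOmmem : ∃ t ∈ Set.Icc (0:ℝ) 1, ∃ u ∈ Set.Icc (0:ℝ) 1, ∃ v ∈ Set.Icc (0:ℝ) 1,
      K t u v = Om)
    (hom : ∀ t ∈ Set.Icc (0:ℝ) 1, ∀ u ∈ Set.Icc (0:ℝ) 1, ∀ v ∈ Set.Icc (0:ℝ) 1,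
      om ≤ K t u v)
    (hommem : ∃ t ∈ Set.Icc (0:ℝ) 1, ∃ u ∈ Set.Icc (0:ℝ) 1, ∃ v ∈ Set.Icc (0:ℝ) 1,
      K t u v = om)
    (hc1 : 1 < c) (hc2 : c < (1 / 2) * Real.sqrt (Real.sqrt 17 + 1))
    (hcond : Om < c * om) :
    ∃ g : ℝ → ℝ,
      (ContinuousOn g (Set.Icc 0 1) ∧
        (∀ t ∈ Set.Icc (0:ℝ) 1, 0 ≤ g t) ∧
        (∃ t ∈ Set.Icc (0:ℝ) 1, g t ≠ 0) ∧
        (∀ t ∈ Set.Icc (0:ℝ) 1, lyap K g t = g t)) ∧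
      ∀ g' : ℝ → ℝ,
        (ContinuousOn g' (Set.Icc 0 1) ∧
          (∀ t ∈ Set.Icc (0:ℝ) 1, 0 ≤ g' t) ∧
          (∃ t ∈ Set.Icc (0:ℝ) 1, g' t ≠ 0) ∧
          (∀ t ∈ Set.Icc (0:ℝ) 1, lyap K g' t = g' t)) →
        Set.EqOn g' g (Set.Icc 0 1) := by
  let k : C(unitInterval × unitInterval × unitInterval, ℝ) :=
    ⟨fun q => K q.1 q.2.1 q.2.2, hK.comp_continuous
      (f := fun q : unitInterval × unitInterval × unitInterval =>
        ((q.1 : ℝ), (q.2.1 : ℝ), (q.2.2 : ℝ))) (by fun_prop)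
      fun q => ⟨q.1.2, q.2.1.2, q.2.2.2⟩⟩
  have hk : ∀ t u v : unitInterval, k (t, u, v) = K t u v := fun _ _ _ => rfl
  have hom0 : 0 < om := by
    obtain ⟨t, ht, u, hu, v, hv, h⟩ := hommem
    exact h ▸ hKpos t ht u hu v hv
  have hcsq : c ^ 2 < 3 / 2 := by
    have h17 : Real.sqrt 17 < 5 := (Real.sqrt_lt' (by norm_num)).2 (by norm_num)
    have hsq := Real.sq_sqrt (show 0 ≤ Real.sqrt 17 + 1 by positivity)
    nlinarith
  obtain ⟨G, ⟨hG0, hGne, hGfix⟩, hGuniq⟩ :=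
    exists_unique_fixedPoint_quadOp (volume : Measure unitInterval) (k := k) hom0
      (fun q => hom _ q.1.2 _ q.2.1.2 _ q.2.2.2) (fun q => hOm _ q.1.2 _ q.2.1.2 _ q.2.2.2)
      hcond.le hc1.le hcsq
  have hext : ∀ t : unitInterval, G t = IccExtend zero_le_one G t :=
    fun t => (IccExtend_val zero_le_one G t).symm
  refine ⟨IccExtend zero_le_one G, ⟨(G.continuous.Icc_extend' (h := zero_le_one)).continuousOn,
    fun t ht => hG0 _, ?_, fun t ht => ?_⟩, ?_⟩
  · obtain ⟨t, ht⟩ := DFunLike.ne_iff.1 hGne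
    exact ⟨t, t.2, by rw [← hext]; exact ht⟩
  · rw [lyap_eq_quadOp hk hext ⟨t, ht⟩, hGfix]
    exact hext ⟨t, ht⟩
  · rintro g' ⟨hcont, hg0, ⟨t₀, ht₀, hne⟩, hfix⟩ t ht
    have hF := hGuniq ⟨(Icc 0 1).domRestrict g', hcont.domRestrict⟩ ⟨fun t => hg0 t t.2,
      fun h => hne (DFunLike.congr_fun h ⟨t₀, ht₀⟩), by
        ext t
        rw [← lyap_eq_quadOp hk (f := g') (fun _ => rfl)]
        exact hfix t t.2⟩
    rw [← hext ⟨t, ht⟩, ← hF]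
    rfl
end
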